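/- Let d ≥ 2 be an integer, ε > 0, let (α,β) ∈ ℝ² be admissible with (d,α) ≠ (2,0), μ̄ := max(2α+dβ, 2α+(d−2)β), and let f : ℝ → ℝ be twice differentiable satisfying the convexity conditions with parameter ε and strong subcritical growth. Assume the set S of real-valued Schwartz functions φ ≢ 0 on ℝ^d with K_{α,β}(φ) = 0 is nonempty, and let m := inf_{ψ ∈ S} J(ψ) (a nonnegative real number). Then there exists δ > 0, depending only on d, α, β, ε, such that every real-valued Schwartz function φ with J(φ) < m satisfies either K_{α,β}(φ) ≥ min(μ̄·(m − J(φ)), δ·K^Q_{α,β}(φ)) or K_{α,β}(φ) ≤ −μ̄·(m − J(φ)). -/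

import Mathlib

noncomputable def gradN2 {d : ℕ} (u : EuclideanSpace ℝ (Fin d) → ℝ) : ℝ :=
  ∫ x, ‖fderiv ℝ u x‖^2

noncomputable def massN2 {d : ℕ} (u : EuclideanSpace ℝ (Fin d) → ℝ) : ℝ :=
  ∫ x, (u x)^2

noncomputable def Ffun {d : ℕ} (f : ℝ → ℝ) (u : EuclideanSpace ℝ (Fin d) → ℝ) : ℝ :=
  ∫ x, f (u x)

noncomputable def Jfun {d : ℕ} (f : ℝ → ℝ) (u : EuclideanSpace ℝ (Fin d) → ℝ) : ℝ :=
  (gradN2 u + massN2 u) / 2 - Ffun f u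

noncomputable def KQfun {d : ℕ} (α β : ℝ) (u : EuclideanSpace ℝ (Fin d) → ℝ) : ℝ :=
  ((2*α + ((d:ℝ)-2)*β)/2) * gradN2 u + ((2*α + (d:ℝ)*β)/2) * massN2 u

noncomputable def Kfun {d : ℕ} (f : ℝ → ℝ) (α β : ℝ)
    (u : EuclideanSpace ℝ (Fin d) → ℝ) : ℝ :=
  KQfun α β u - ∫ x, (α * u x * deriv f (u x) + (d:ℝ) * β * f (u x))

section Auxiliary

open MeasureTheory Set

/-- `g` is dominated by a sum of two powers, with a fixed constant. -/
def PowerBounded (q₁ q₂ : ℝ) (g : ℝ → ℝ) : Prop :=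
  ∃ C : ℝ, 0 ≤ C ∧ ∀ u : ℝ, |g u| ≤ C * (|u| ^ q₁ + |u| ^ q₂)

lemma PowerBounded.const_mul {q₁ q₂ : ℝ} {g : ℝ → ℝ} (hg : PowerBounded q₁ q₂ g) (a : ℝ) :
    PowerBounded q₁ q₂ (fun u => a * g u) := by
  obtain ⟨C, hC, h⟩ := hg
  refine ⟨|a| * C, by positivity, fun u => ?_⟩
  rw [abs_mul, mul_assoc]
  exact mul_le_mul_of_nonneg_left (h u) (abs_nonneg a)

lemma PowerBounded.add {q₁ q₂ : ℝ} {g h : ℝ → ℝ} (hg : PowerBounded q₁ q₂ g)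
    (hh : PowerBounded q₁ q₂ h) : PowerBounded q₁ q₂ (fun u => g u + h u) := by
  obtain ⟨C, hC, hgC⟩ := hg
  obtain ⟨D, hD, hhD⟩ := hh
  refine ⟨C + D, by positivity, fun u => ?_⟩
  rw [add_mul]
  exact (abs_add_le _ _).trans (add_le_add (hgC u) (hhD u))

section Schwartz

variable {d : ℕ} (φ : SchwartzMap (EuclideanSpace ℝ (Fin d)) ℝ)

lemma SchwartzMap.integrable_abs_rpow {q : ℝ} (hq : 0 < q) :
    Integrable (fun x => |φ x| ^ q) := by
  have h := (φ.memLp (ENNReal.ofReal q)).integrable_norm_rpow (by simpa using hq)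
    ENNReal.ofReal_ne_top
  simpa [ENNReal.toReal_ofReal hq.le] using h

lemma SchwartzMap.integrable_powers {q₁ q₂ : ℝ} (hq₁ : 0 < q₁) (hq₂ : 0 < q₂) (C c : ℝ) :
    Integrable (fun x => C * (|c * φ x| ^ q₁ + |c * φ x| ^ q₂)) := by
  simp only [abs_mul, Real.mul_rpow (abs_nonneg _) (abs_nonneg _)]
  exact (((φ.integrable_abs_rpow hq₁).const_mul _).add
    ((φ.integrable_abs_rpow hq₂).const_mul _)).const_mul C

lemma PowerBounded.integrable_comp {q₁ q₂ : ℝ} (hq₁ : 0 < q₁) (hq₂ : 0 < q₂) {g : ℝ → ℝ}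
    (hgm : Measurable g) (hg : PowerBounded q₁ q₂ g) (c : ℝ) :
    Integrable (fun x => g (c * φ x)) := by
  obtain ⟨C, hC, h⟩ := hg
  refine (φ.integrable_powers hq₁ hq₂ C c).mono' ?_ (.of_forall fun x => h _)
  exact (hgm.comp (φ.continuous.measurable.const_mul c)).aestronglyMeasurable

/-- Differentiation of the nonlinear functional along the two-parameter scaling flow. -/
lemma hasDerivAt_exp_mul_integral_comp {q₁ q₂ : ℝ} (hq₁ : 0 < q₁) (hq₂ : 0 < q₂) {g : ℝ → ℝ}
    (hgd : Differentiable ℝ g) (hg : PowerBounded q₁ q₂ g)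
    (hg' : PowerBounded q₁ q₂ (fun u => u * deriv g u)) (a b t : ℝ) :
    HasDerivAt (fun t => Real.exp (b * t) * ∫ x, g (Real.exp (a * t) * φ x))
      (Real.exp (b * t) * ∫ x, (a * (Real.exp (a * t) * φ x * deriv g (Real.exp (a * t) * φ x))
        + b * g (Real.exp (a * t) * φ x))) t := by
  have hgm : Measurable g := hgd.continuous.measurable
  have hgm' : Measurable (fun u => u * deriv g u) := measurable_id.mul (measurable_deriv g)
  obtain ⟨C, hC, hgC⟩ := hg'.const_mul a
  have hint := fun s => PowerBounded.integrable_comp φ hq₁ hq₂ hgm hg (Real.exp (a * s))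
  have hint' := PowerBounded.integrable_comp φ hq₁ hq₂ hgm' hg' (Real.exp (a * t))
  have key := (hasDerivAt_integral_of_dominated_loc_of_deriv_le (μ := volume)
    (F := fun s x => g (Real.exp (a * s) * φ x))
    (F' := fun s x => a * (Real.exp (a * s) * φ x * deriv g (Real.exp (a * s) * φ x)))
    (bound := fun x => C * (|Real.exp (|a| * (|t| + 1)) * φ x| ^ q₁
      + |Real.exp (|a| * (|t| + 1)) * φ x| ^ q₂))
    (Metric.ball_mem_nhds t one_pos) (.of_forall fun s => (hint s).aestronglyMeasurable)
    (hint t) (hint'.const_mul a).aestronglyMeasurable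
    (.of_forall fun x s hs => ?_) (φ.integrable_powers hq₁ hq₂ _ _)
    (.of_forall fun x s _ => ?_)).2
  · have hexp : HasDerivAt (fun t => Real.exp (b * t)) (Real.exp (b * t) * b) t := by
      simpa using ((hasDerivAt_id t).const_mul b).exp
    refine (hexp.mul key).congr_deriv ?_
    rw [integral_add (hint'.const_mul a) ((hint t).const_mul b), integral_const_mul b]
    ring
  · refine (hgC _).trans (mul_le_mul_of_nonneg_left ?_ hC)
    have hs' : |s| ≤ |t| + 1 := by
      have h1 : |s - t| < 1 := by simpa [Real.dist_eq] using hs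
      have h2 := abs_sub_abs_le_abs_sub s t
      linarith
    have hle : |Real.exp (a * s) * φ x| ≤ |Real.exp (|a| * (|t| + 1)) * φ x| := by
      rw [abs_mul, abs_mul, Real.abs_exp, Real.abs_exp]
      refine mul_le_mul_of_nonneg_right (Real.exp_le_exp.2 ?_) (abs_nonneg _)
      calc a * s ≤ |a| * |s| := by rw [← abs_mul]; exact le_abs_self _
        _ ≤ |a| * (|t| + 1) := by gcongr
    gcongr
  · have h1 : HasDerivAt (fun s => Real.exp (a * s) * φ x) (a * (Real.exp (a * s) * φ x)) s := by
      refine ((((hasDerivAt_id s).const_mul a).exp).mul_const (φ x)).congr_deriv ?_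
      simp only [id]; ring
    refine ((hgd (Real.exp (a * s) * φ x)).hasDerivAt.comp s h1).congr_deriv ?_
    ring

/-- The rescaled function `x ↦ e ^ s * φ (e ^ (-t) x)`. -/
noncomputable def SchwartzMap.rescale (s t : ℝ) : SchwartzMap (EuclideanSpace ℝ (Fin d)) ℝ :=
  Real.exp s • SchwartzMap.compCLMOfContinuousLinearEquiv ℝ
    (ContinuousLinearEquiv.smulLeft (Units.mk0 (Real.exp t)⁻¹ (by positivity))) φ

lemma SchwartzMap.rescale_apply (s t : ℝ) (x : EuclideanSpace ℝ (Fin d)) :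
    φ.rescale s t x = Real.exp s * φ ((Real.exp t)⁻¹ • x) := rfl

lemma SchwartzMap.coe_rescale (s t : ℝ) :
    ⇑(φ.rescale s t) = fun x => Real.exp s * φ ((Real.exp t)⁻¹ • x) := rfl

lemma SchwartzMap.rescale_ne_zero {φ : SchwartzMap (EuclideanSpace ℝ (Fin d)) ℝ} (hφ : φ ≠ 0)
    (s t : ℝ) : φ.rescale s t ≠ 0 := by
  intro h
  apply hφ
  ext x
  have := DFunLike.congr_fun h (Real.exp t • x)
  simpa [SchwartzMap.rescale_apply, smul_smul] using this

lemma integral_comp_rescale (G : ℝ → ℝ) (s t : ℝ) :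
    ∫ x, G (φ.rescale s t x) = Real.exp (d * t) * ∫ x, G (Real.exp s * φ x) := by
  simp only [SchwartzMap.rescale_apply]
  rw [Measure.integral_comp_inv_smul_of_nonneg volume (fun x => G (Real.exp s * φ x))
    (Real.exp_pos t).le]
  simp [← Real.exp_nat_mul]

lemma massN2_rescale (s t : ℝ) :
    massN2 (φ.rescale s t) = Real.exp (2 * s + d * t) * massN2 φ := by
  unfold massN2
  rw [integral_comp_rescale φ (fun u => u ^ 2) s t]
  simp only [mul_pow, integral_const_mul]
  rw [← mul_assoc, ← Real.exp_nat_mul, ← Real.exp_add]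
  congr 2
  push_cast; ring

lemma gradN2_rescale (s t : ℝ) :
    gradN2 (φ.rescale s t) = Real.exp (2 * s + (d - 2) * t) * gradN2 φ := by
  unfold gradN2
  have h : ∀ x, ‖fderiv ℝ (φ.rescale s t) x‖ ^ 2
      = Real.exp (2 * s - 2 * t) * ‖fderiv ℝ φ ((Real.exp t)⁻¹ • x)‖ ^ 2 := by
    intro x
    have h1 : fderiv ℝ (φ.rescale s t) x
        = Real.exp s • ((Real.exp t)⁻¹ • fderiv ℝ φ ((Real.exp t)⁻¹ • x)) := by
      rw [SchwartzMap.coe_rescale, fderiv_const_mul, fderiv_comp_smul]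
      exact φ.differentiableAt.comp x (by fun_prop)
    rw [h1, norm_smul, norm_smul, Real.norm_eq_abs, Real.norm_eq_abs, ← Real.exp_neg,
      Real.abs_exp, Real.abs_exp, ← mul_assoc, mul_pow, ← Real.exp_add, ← Real.exp_nat_mul]
    congr 2
    push_cast; ring
  simp only [h, integral_const_mul]
  rw [Measure.integral_comp_inv_smul_of_nonneg volume (fun x => ‖fderiv ℝ φ x‖ ^ 2)
    (Real.exp_pos t).le]
  simp only [finrank_euclideanSpace, Fintype.card_fin, smul_eq_mul, ← Real.exp_nat_mul]
  rw [← mul_assoc, ← Real.exp_add]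
  congr 2
  ring

lemma gradN2_nonneg : 0 ≤ gradN2 φ := integral_nonneg fun _ => by positivity

lemma massN2_nonneg : 0 ≤ massN2 φ := integral_nonneg fun _ => by positivity

variable {φ}

lemma massN2_pos (hφ : φ ≠ 0) : 0 < massN2 φ := by
  refine lt_of_le_of_ne (massN2_nonneg φ) fun h => hφ ?_
  have hint : Integrable (fun x => φ x ^ 2) := (φ.memLp 2).integrable_sq
  have h0 := (integral_eq_zero_iff_of_nonneg (fun x => sq_nonneg (φ x)) hint).1 h.symm
  have h1 := (Continuous.ae_eq_iff_eq volume (by fun_prop) continuous_const).1 h0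
  ext x
  exact pow_eq_zero_iff two_ne_zero |>.1 (congrFun h1 x)

lemma gradN2_pos (hd : 0 < d) (hφ : φ ≠ 0) : 0 < gradN2 φ := by
  refine lt_of_le_of_ne (gradN2_nonneg φ) fun h => hφ ?_
  have hmem := (SchwartzMap.fderivCLM ℝ (EuclideanSpace ℝ (Fin d)) ℝ φ).memLp 2
  have hcont := (SchwartzMap.fderivCLM ℝ (EuclideanSpace ℝ (Fin d)) ℝ φ).continuous
  have hint : Integrable (fun x => ‖fderiv ℝ φ x‖ ^ 2) := by
    simpa using hmem.norm.integrable_sq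
  have h0 := (integral_eq_zero_iff_of_nonneg (fun x => by positivity) hint).1 h.symm
  have hcont' : Continuous (fderiv ℝ φ) := hcont
  have h1 := (Continuous.ae_eq_iff_eq volume (by fun_prop) continuous_const).1 h0
  have h2 : ∀ x y, φ x = φ y :=
    is_const_of_fderiv_eq_zero φ.differentiable fun x =>
      norm_eq_zero.1 (pow_eq_zero_iff two_ne_zero |>.1 (congrFun h1 x))
  have h3 : Integrable (fun _ : EuclideanSpace ℝ (Fin d) => φ 0) := by
    have := φ.integrable (μ := volume)
    convert this using 1
    ext x
    exact h2 0 x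
  have : Nonempty (Fin d) := ⟨⟨0, hd⟩⟩
  have h4 : φ 0 = 0 := by
    rcases integrable_const_iff.1 h3 with h | h
    · exact h
    · exact absurd (isFiniteMeasure_iff _ |>.1 h) (by simp)
  ext x
  simpa [h4] using h2 x 0

end Schwartz

lemma hasDerivAt_exp_neg_mul_mul {y : ℝ → ℝ} {y' t : ℝ} (hy : HasDerivAt y y' t) (μ : ℝ) :
    HasDerivAt (fun t => Real.exp (-(μ * t)) * y t)
      (Real.exp (-(μ * t)) * (y' - μ * y t)) t := by
  have h1 : HasDerivAt (fun t => Real.exp (-(μ * t))) (Real.exp (-(μ * t)) * (-μ)) t := by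
    simpa using ((hasDerivAt_id t).const_mul μ).neg.exp
  refine (h1.mul hy).congr_deriv ?_
  ring

/-- A Gronwall-type growth bound. -/
lemma monotone_exp_neg_mul {y y' : ℝ → ℝ} {μ : ℝ} (hy : ∀ t, HasDerivAt y (y' t) t)
    (h : ∀ t, μ * y t ≤ y' t) : Monotone fun t => Real.exp (-(μ * t)) * y t :=
  monotone_of_hasDerivAt_nonneg (fun t => hasDerivAt_exp_neg_mul_mul (hy t) μ)
    fun t => mul_nonneg (Real.exp_pos _).le (by linarith [h t])

/-- If the derivative `k` of `s` satisfies `k' ≤ μ k - a h` with `h` nondecreasing and `k 0` is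
positive but small relative to `h 0`, then `k` vanishes later and `k + μ s` has decreased. -/
lemma exists_zero_right {s k k' h h' : ℝ → ℝ} {μ a : ℝ} (hμ : 0 < μ) (ha : 0 ≤ a)
    (hs : ∀ t, HasDerivAt s (k t) t) (hk : ∀ t, HasDerivAt k (k' t) t)
    (hh : ∀ t, HasDerivAt h (h' t) t) (hh' : ∀ t, 0 ≤ h' t)
    (hk' : ∀ t, k' t ≤ μ * k t - a * h t) (hk0 : 0 < k 0) (hkh : 2 * μ * k 0 ≤ a * h 0) :
    ∃ t, k t = 0 ∧ μ * s t ≤ k 0 + μ * s 0 := by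
  have hmono : Monotone h := monotone_of_hasDerivAt_nonneg hh hh'
  have hkc : Continuous k := continuous_iff_continuousAt.2 fun t => (hk t).continuousAt
  set c := a * h 0 / μ with hc
  have hμc : μ * c = a * h 0 := mul_div_cancel₀ _ hμ.ne'
  have hc2 : 2 * k 0 ≤ c := by rw [hc, le_div_iff₀ hμ]; linarith
  have hd := fun t => hasDerivAt_exp_neg_mul_mul ((hk t).sub_const c) μ
  have hanti : AntitoneOn (fun t => Real.exp (-(μ * t)) * (k t - c)) (Ici 0) := by
    refine antitoneOn_of_deriv_nonpos (convex_Ici 0)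
      (fun t _ => (hd t).continuousAt.continuousWithinAt)
      (fun t _ => (hd t).differentiableAt.differentiableWithinAt) fun t ht => ?_
    rw [interior_Ici] at ht
    rw [(hd t).deriv]
    refine mul_nonpos_of_nonneg_of_nonpos (Real.exp_pos _).le ?_
    have h1 : a * h 0 ≤ a * h t := mul_le_mul_of_nonneg_left (hmono (le_of_lt ht)) ha
    have := hk' t
    rw [mul_sub, hμc]
    linarith
  have hbound : ∀ t, 0 ≤ t → Real.exp (-(μ * t)) * (k t - c) ≤ - (c / 2) := by
    intro t ht
    have := hanti self_mem_Ici ht ht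
    simp only [mul_zero, neg_zero, Real.exp_zero, one_mul] at this
    linarith
  set T := Real.log 2 / μ with hT
  have hTpos : 0 < T := div_pos (Real.log_pos one_lt_two) hμ
  have hkT : k T ≤ 0 := by
    have hexpT : Real.exp (-(μ * T)) = 1 / 2 := by
      rw [hT, mul_div_cancel₀ _ hμ.ne', Real.exp_neg, Real.exp_log two_pos]; norm_num
    have := hbound T hTpos.le
    rw [hexpT] at this
    linarith
  obtain ⟨t, ht, hkt⟩ := intermediate_value_Icc' hTpos.le hkc.continuousOn
    (show (0 : ℝ) ∈ Icc (k T) (k 0) from ⟨hkT, hk0.le⟩)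
  refine ⟨t, hkt, ?_⟩
  have hd2 : ∀ r, HasDerivAt (fun r => k r + μ * s r) (k' r + μ * k r) r :=
    fun r => (hk r).add ((hs r).const_mul μ)
  have hanti2 : AntitoneOn (fun r => k r + μ * s r) (Ici 0) := by
    refine antitoneOn_of_deriv_nonpos (convex_Ici 0)
      (fun t _ => (hd2 t).continuousAt.continuousWithinAt)
      (fun t _ => (hd2 t).differentiableAt.differentiableWithinAt) fun r hr => ?_
    rw [interior_Ici] at hr
    replace hr : 0 < r := hr
    rw [(hd2 r).deriv]
    have h1 : a * h 0 ≤ a * h r := mul_le_mul_of_nonneg_left (hmono hr.le) ha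
    have h2 := hbound r hr.le
    have h3 : Real.exp (-(μ * r)) ≤ 1 := Real.exp_le_one_iff.2 (by nlinarith)
    have h4 : 0 < Real.exp (-(μ * r)) := Real.exp_pos _
    have h5 : k r ≤ c / 2 := by
      by_contra hcon
      push Not at hcon
      nlinarith
    have h6 : 2 * (μ * k r) ≤ μ * c := by nlinarith
    linarith [hk' r]
  have := hanti2 self_mem_Ici ht.1 ht.1
  simpa [hkt] using this

lemma exists_zero_left {s k k' : ℝ → ℝ} {μ : ℝ}
    (hs : ∀ t, HasDerivAt s (k t) t) (hk : ∀ t, HasDerivAt k (k' t) t)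
    (hk' : ∀ t, k' t ≤ μ * k t) (hk0 : k 0 ≤ 0) (hpos : ∃ t ≤ 0, 0 ≤ k t) :
    ∃ t, k t = 0 ∧ k 0 - μ * s 0 ≤ -(μ * s t) := by
  obtain ⟨T, hT, hkT⟩ := hpos
  have hkc : Continuous k := continuous_iff_continuousAt.2 fun t => (hk t).continuousAt
  obtain ⟨t, ht, hkt⟩ := intermediate_value_Icc' hT hkc.continuousOn
    (show (0 : ℝ) ∈ Icc (k 0) (k T) from ⟨hk0, hkT⟩)
  refine ⟨t, hkt, ?_⟩
  have hanti : Antitone (fun t => k t - μ * s t) :=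
    antitone_of_hasDerivAt_nonpos (fun t => (hk t).sub ((hs t).const_mul μ))
      fun t => by simpa using hk' t
  have := hanti ht.2
  simp only [hkt] at this
  linarith

lemma exists_le_zero_mul_exp_le {A c : ℝ} (B : ℝ) (hA : 0 < A) (hc : 0 < c) :
    ∃ t ≤ 0, B * Real.exp (c * t) ≤ A := by
  have hpos : 0 < A / (A + |B|) := by positivity
  refine ⟨Real.log (A / (A + |B|)) / c,
    div_nonpos_of_nonpos_of_nonneg (Real.log_nonpos hpos.le ?_) hc.le, ?_⟩
  · exact (div_le_one (by positivity)).2 (by linarith [abs_nonneg B])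
  · rw [mul_div_cancel₀ _ hc.ne', Real.exp_log hpos, mul_div_assoc', div_le_iff₀ (by positivity)]
    nlinarith [le_abs_self B]

/-- The density of the nonlinear part of `Kfun`, with `b = d * β`. -/
noncomputable def fluxDensity (f : ℝ → ℝ) (a b : ℝ) (u : ℝ) : ℝ := a * u * deriv f u + b * f u

/-- Convexity and growth conditions with superquadraticity exponent `p`. -/
structure ConvexNonlinearity (p q₁ q₂ : ℝ) (f : ℝ → ℝ) : Prop where
  diff : Differentiable ℝ f
  diff_deriv : Differentiable ℝ (deriv f)
  nonneg : ∀ u, 0 ≤ f u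
  superquadratic : ∀ u, p * f u ≤ u * deriv f u
  convex : ∀ u, 0 ≤ u ^ 2 * deriv (deriv f) u - (1 + p) * (u * deriv f u) + 2 * p * f u
  bounded : PowerBounded q₁ q₂ f
  bounded_deriv : PowerBounded q₁ q₂ (fun u => u * deriv f u)
  bounded_deriv_deriv : PowerBounded q₁ q₂ (fun u => u ^ 2 * deriv (deriv f) u)
  pos₁ : 0 < q₁
  pos₂ : 0 < q₂

namespace ConvexNonlinearity

variable {p q₁ q₂ : ℝ} {f : ℝ → ℝ} (hf : ConvexNonlinearity p q₁ q₂ f)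
include hf

lemma hasDerivAt_fluxDensity (a b u : ℝ) :
    HasDerivAt (fluxDensity f a b)
      (a * deriv f u + a * u * deriv (deriv f) u + b * deriv f u) u := by
  have h1 : HasDerivAt (fun u : ℝ => a * u) a u := by
    simpa using (hasDerivAt_id u).const_mul a
  exact (h1.mul (hf.diff_deriv u).hasDerivAt).add ((hf.diff u).hasDerivAt.const_mul b)

lemma mul_deriv_fluxDensity (a b u : ℝ) :
    u * deriv (fluxDensity f a b) u
      = (a + b) * (u * deriv f u) + a * (u ^ 2 * deriv (deriv f) u) := by
  rw [(hf.hasDerivAt_fluxDensity a b u).deriv]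
  ring

lemma bounded_fluxDensity (a b : ℝ) : PowerBounded q₁ q₂ (fluxDensity f a b) := by
  have := (hf.bounded_deriv.const_mul a).add (hf.bounded.const_mul b)
  unfold fluxDensity
  simpa only [mul_assoc] using this

lemma bounded_mul_deriv_fluxDensity (a b : ℝ) :
    PowerBounded q₁ q₂ (fun u => u * deriv (fluxDensity f a b) u) := by
  simp only [hf.mul_deriv_fluxDensity]
  exact (hf.bounded_deriv.const_mul _).add (hf.bounded_deriv_deriv.const_mul _)

lemma le_fluxDensity {a : ℝ} (ha : 0 ≤ a) (b u : ℝ) :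
    (a * p + b) * f u ≤ fluxDensity f a b u := by
  have := mul_le_mul_of_nonneg_left (hf.superquadratic u) ha
  unfold fluxDensity
  nlinarith

lemma mul_fluxDensity_le {a b c : ℝ} (ha : 0 ≤ a) (hab : 0 ≤ 2 * a + b) (hc0 : 0 ≤ c)
    (hc : c ≤ a * p + b) (u : ℝ) : c * fluxDensity f a b u
      ≤ a * (u * deriv (fluxDensity f a b) u) + b * fluxDensity f a b u := by
  rw [hf.mul_deriv_fluxDensity]
  have h1 := mul_nonneg (sq_nonneg a) (hf.convex u)
  have h2 : 0 ≤ a * (a * (2 + p) + 2 * b - c) := mul_nonneg ha (by nlinarith)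
  have h3 := mul_nonneg h2 (sub_nonneg.2 (hf.superquadratic u))
  unfold fluxDensity
  have h4 := mul_nonneg (mul_nonneg (hc0.trans hc) (sub_nonneg.2 hc)) (hf.nonneg u)
  nlinarith

section Flow

variable {d : ℕ} (φ : SchwartzMap (EuclideanSpace ℝ (Fin d)) ℝ)

lemma integrable_comp (c : ℝ) : Integrable (fun x => f (c * φ x)) :=
  PowerBounded.integrable_comp φ hf.pos₁ hf.pos₂ hf.diff.continuous.measurable hf.bounded c

lemma integrable_fluxDensity (a b c : ℝ) : Integrable (fun x => fluxDensity f a b (c * φ x)) :=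
  PowerBounded.integrable_comp φ hf.pos₁ hf.pos₂
    (Differentiable.continuous fun u =>
      (hf.hasDerivAt_fluxDensity a b u).differentiableAt).measurable
    (hf.bounded_fluxDensity a b) c

end Flow

end ConvexNonlinearity

section Flow

variable {d : ℕ} (φ : SchwartzMap (EuclideanSpace ℝ (Fin d)) ℝ)

/-- The nonlinear part of `Kfun` along the scaling flow. -/
noncomputable def fluxFlow (f : ℝ → ℝ) (a b t : ℝ) : ℝ :=
  Real.exp (b * t) * ∫ x, fluxDensity f a b (Real.exp (a * t) * φ x)

/-- The derivative of `fluxFlow`. -/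
noncomputable def fluxFlowDeriv (f : ℝ → ℝ) (a b t : ℝ) : ℝ :=
  Real.exp (b * t) * ∫ x, (a * (Real.exp (a * t) * φ x *
    deriv (fluxDensity f a b) (Real.exp (a * t) * φ x))
    + b * fluxDensity f a b (Real.exp (a * t) * φ x))

lemma SchwartzMap.rescale_zero : φ.rescale 0 0 = φ := by
  ext x
  simp [SchwartzMap.rescale_apply]

lemma Jfun_rescale (f : ℝ → ℝ) (a b t : ℝ) :
    Jfun f (φ.rescale (a * t) (b * t)) =
      (Real.exp ((2 * a + (d - 2) * b) * t) * gradN2 φ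
        + Real.exp ((2 * a + d * b) * t) * massN2 φ) / 2
      - Real.exp (d * b * t) * ∫ x, f (Real.exp (a * t) * φ x) := by
  unfold Jfun Ffun
  rw [gradN2_rescale, massN2_rescale, integral_comp_rescale]
  ring_nf

lemma Kfun_rescale (f : ℝ → ℝ) (a b t : ℝ) :
    Kfun f a b (φ.rescale (a * t) (b * t)) =
      ((2 * a + (d - 2) * b) * (Real.exp ((2 * a + (d - 2) * b) * t) * gradN2 φ)
        + (2 * a + d * b) * (Real.exp ((2 * a + d * b) * t) * massN2 φ)) / 2
      - fluxFlow φ f a (d * b) t := by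
  unfold Kfun KQfun fluxFlow
  have h := integral_comp_rescale φ (fluxDensity f a (d * b)) (a * t) (b * t)
  simp only [fluxDensity] at h ⊢
  rw [gradN2_rescale, massN2_rescale, h]
  ring_nf

variable {p q₁ q₂ : ℝ} {f : ℝ → ℝ} (hf : ConvexNonlinearity p q₁ q₂ f)
include hf

lemma hasDerivAt_fluxFlow (a b t : ℝ) :
    HasDerivAt (fluxFlow φ f a b) (fluxFlowDeriv φ f a b t) t :=
  hasDerivAt_exp_mul_integral_comp φ hf.pos₁ hf.pos₂
    (fun u => (hf.hasDerivAt_fluxDensity a b u).differentiableAt)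
    (hf.bounded_fluxDensity a b) (hf.bounded_mul_deriv_fluxDensity a b) a b t

lemma hasDerivAt_exp_mul_integral_nonlinearity (a b t : ℝ) :
    HasDerivAt (fun t => Real.exp (b * t) * ∫ x, f (Real.exp (a * t) * φ x))
      (fluxFlow φ f a b t) t := by
  have := hasDerivAt_exp_mul_integral_comp φ hf.pos₁ hf.pos₂ hf.diff hf.bounded
    hf.bounded_deriv a b t
  simpa only [fluxFlow, fluxDensity, mul_assoc] using this

omit hf in
lemma hasDerivAt_exp_mul_const (c G t : ℝ) :
    HasDerivAt (fun t => Real.exp (c * t) * G) (c * (Real.exp (c * t) * G)) t := by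
  refine (((hasDerivAt_id t).const_mul c).exp.mul_const G).congr_deriv ?_
  simp only [id]; ring

lemma hasDerivAt_Jfun_rescale (a b t : ℝ) :
    HasDerivAt (fun t => Jfun f (φ.rescale (a * t) (b * t)))
      (Kfun f a b (φ.rescale (a * t) (b * t))) t := by
  simp only [Jfun_rescale, Kfun_rescale]
  exact (((hasDerivAt_exp_mul_const _ _ t).add (hasDerivAt_exp_mul_const _ _ t)).div_const 2).sub
    (hasDerivAt_exp_mul_integral_nonlinearity φ hf a (d * b) t)

lemma hasDerivAt_Kfun_rescale (a b t : ℝ) :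
    HasDerivAt (fun t => Kfun f a b (φ.rescale (a * t) (b * t)))
      (((2 * a + (d - 2) * b) * ((2 * a + (d - 2) * b) *
          (Real.exp ((2 * a + (d - 2) * b) * t) * gradN2 φ))
        + (2 * a + d * b) * ((2 * a + d * b) * (Real.exp ((2 * a + d * b) * t) * massN2 φ))) / 2
      - fluxFlowDeriv φ f a (d * b) t) t := by
  simp only [Kfun_rescale]
  exact ((((hasDerivAt_exp_mul_const _ _ t).const_mul _).add
    ((hasDerivAt_exp_mul_const _ _ t).const_mul _)).div_const 2).sub
    (hasDerivAt_fluxFlow φ hf a (d * b) t)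

lemma mul_integral_le_fluxFlow {a : ℝ} (ha : 0 ≤ a) (b t : ℝ) :
    (a * p + b) * (Real.exp (b * t) * ∫ x, f (Real.exp (a * t) * φ x)) ≤ fluxFlow φ f a b t := by
  unfold fluxFlow
  rw [mul_left_comm, ← integral_const_mul]
  refine mul_le_mul_of_nonneg_left ?_ (Real.exp_pos _).le
  exact integral_mono ((hf.integrable_comp φ _).const_mul _) (hf.integrable_fluxDensity φ a b _)
    fun x => hf.le_fluxDensity ha b _

lemma fluxFlow_nonneg {a b : ℝ} (ha : 0 ≤ a) (hab : 0 ≤ a * p + b) (t : ℝ) :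
    0 ≤ fluxFlow φ f a b t :=
  le_trans (mul_nonneg hab (mul_nonneg (Real.exp_pos _).le (integral_nonneg fun _ => hf.nonneg _)))
    (mul_integral_le_fluxFlow φ hf ha b t)

lemma mul_fluxFlow_le {a b c : ℝ} (ha : 0 ≤ a) (hab : 0 ≤ 2 * a + b) (hc0 : 0 ≤ c)
    (hc : c ≤ a * p + b) (t : ℝ) :
    c * fluxFlow φ f a b t ≤ fluxFlowDeriv φ f a b t := by
  unfold fluxFlow fluxFlowDeriv
  rw [mul_left_comm, ← integral_const_mul]
  refine mul_le_mul_of_nonneg_left ?_ (Real.exp_pos _).le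
  refine integral_mono ((hf.integrable_fluxDensity φ a b _).const_mul _) (.add ?_ ?_)
    fun x => hf.mul_fluxDensity_le ha hab hc0 hc _
  · refine Integrable.const_mul ?_ a
    exact PowerBounded.integrable_comp φ hf.pos₁ hf.pos₂ (measurable_id.mul (measurable_deriv _))
      (hf.bounded_mul_deriv_fluxDensity a b) _
  · exact (hf.integrable_fluxDensity φ a b _).const_mul _

lemma Jfun_nonneg_of_Kfun_eq_zero {a b μ : ℝ} (ha : 0 ≤ a) (hμ : 0 < μ)
    (h1 : 2 * a + (d - 2) * b ≤ μ) (h2 : 2 * a + d * b ≤ μ) (hμp : μ ≤ a * p + d * b)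
    (hK : Kfun f a b φ = 0) : 0 ≤ Jfun f φ := by
  have hJ := Jfun_rescale φ f a b 0
  have hK' := Kfun_rescale φ f a b 0
  have h3 := mul_integral_le_fluxFlow φ hf ha (d * b) 0
  simp only [mul_zero, Real.exp_zero, one_mul, φ.rescale_zero, hK] at hJ hK' h3
  have h4 : 0 ≤ ∫ x, f (φ x) := integral_nonneg fun _ => hf.nonneg _
  have h5 := mul_le_mul_of_nonneg_right h1 (gradN2_nonneg φ)
  have h6 := mul_le_mul_of_nonneg_right h2 (massN2_nonneg φ)
  have h7 := mul_le_mul_of_nonneg_right hμp h4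
  have h8 : 0 ≤ μ * Jfun f φ := by rw [hJ]; linarith
  exact nonneg_of_mul_nonneg_right h8 hμ

/-- The bounds on `Kfun` below the level `m` when the superquadraticity exponent leaves a gap
`γ > 0`, which happens as soon as the scaling acts on the amplitude. -/
lemma Kfun_dichotomy_of_pos (hd : 0 < d) {a b μ γ m : ℝ} (ha : 0 ≤ a) (hμ : 0 < μ) (hγ : 0 < γ)
    (h1 : 0 ≤ 2 * a + (d - 2) * b) (h2 : 0 ≤ 2 * a + d * b)
    (hμmax : μ = max (2 * a + d * b) (2 * a + (d - 2) * b)) (hμp : μ + γ ≤ a * p + d * b)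
    (hm : ∀ ψ : SchwartzMap (EuclideanSpace ℝ (Fin d)) ℝ, ψ ≠ 0 → Kfun f a b ψ = 0 → m ≤ Jfun f ψ)
    (hφ : φ ≠ 0) :
    (min (μ * (m - Jfun f φ)) (γ / (2 * μ + γ) * KQfun a b φ) ≤ Kfun f a b φ
      ∨ Kfun f a b φ ≤ -(μ * (m - Jfun f φ))) := by
  have hb1 : 2 * a + (d - 2) * b ≤ μ := hμmax ▸ le_max_right _ _
  have hb2 : 2 * a + d * b ≤ μ := hμmax ▸ le_max_left _ _
  have hab : 0 ≤ a * p + d * b := by linarith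
  have hG := gradN2_pos hd hφ
  have hM := massN2_pos hφ
  have hJ := hasDerivAt_Jfun_rescale φ hf a b
  have hK := hasDerivAt_Kfun_rescale φ hf a b
  have hflux := mul_fluxFlow_le φ hf (c := μ + γ) ha h2 (by positivity) hμp
  have hfl0 := fluxFlow_nonneg φ hf ha hab
  have hKbound : ∀ t, ((2 * a + (d - 2) * b) * ((2 * a + (d - 2) * b) *
          (Real.exp ((2 * a + (d - 2) * b) * t) * gradN2 φ))
        + (2 * a + d * b) * ((2 * a + d * b) * (Real.exp ((2 * a + d * b) * t) * massN2 φ))) / 2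
      - fluxFlowDeriv φ f a (d * b) t
      ≤ μ * Kfun f a b (φ.rescale (a * t) (b * t)) - γ * fluxFlow φ f a (d * b) t := by
    intro t
    rw [Kfun_rescale]
    have e1 : 0 ≤ (2 * a + (d - 2) * b) * (Real.exp ((2 * a + (d - 2) * b) * t) * gradN2 φ) := by
      positivity
    have e2 : 0 ≤ (2 * a + d * b) * (Real.exp ((2 * a + d * b) * t) * massN2 φ) := by
      positivity
    have e3 := mul_le_mul_of_nonneg_right hb1 e1
    have e4 := mul_le_mul_of_nonneg_right hb2 e2
    linarith [hflux t]
  have hK0 : Kfun f a b φ = KQfun a b φ - fluxFlow φ f a (d * b) 0 := by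
    have := Kfun_rescale φ f a b 0
    simp only [mul_zero, Real.exp_zero, one_mul, φ.rescale_zero] at this
    rw [this, KQfun]
    ring
  have hKQ : 0 < KQfun a b φ := by
    unfold KQfun
    rcases max_choice (2 * a + (d : ℝ) * b) (2 * a + ((d : ℝ) - 2) * b) with h | h
    · rw [h] at hμmax
      rw [← hμmax]
      positivity
    · rw [h] at hμmax
      rw [← hμmax]
      positivity
  rcases le_or_gt (Kfun f a b φ) 0 with hneg | hpos
  · right
    obtain ⟨t, ht, hle⟩ := exists_zero_left (μ := μ) hJ hK
      (fun t => by linarith [hKbound t, mul_nonneg hγ.le (hfl0 t)])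
      (by simpa [φ.rescale_zero] using hneg) (by
        obtain ⟨t, ht, hle⟩ := exists_le_zero_mul_exp_le (fluxFlow φ f a (d * b) 0) hKQ hγ
        refine ⟨t, ht, ?_⟩
        have hmono := monotone_exp_neg_mul (hasDerivAt_fluxFlow φ hf a (d * b)) hflux ht
        simp only [mul_zero, neg_zero, Real.exp_zero, one_mul] at hmono
        have hfl : fluxFlow φ f a (d * b) t
            ≤ Real.exp (μ * t) * (fluxFlow φ f a (d * b) 0 * Real.exp (γ * t)) := by
          calc fluxFlow φ f a (d * b) t
              = Real.exp ((μ + γ) * t) *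
                (Real.exp (-((μ + γ) * t)) * fluxFlow φ f a (d * b) t) := by
                rw [← mul_assoc, ← Real.exp_add]; simp
            _ ≤ Real.exp ((μ + γ) * t) * fluxFlow φ f a (d * b) 0 := by gcongr
            _ = _ := by rw [add_mul, Real.exp_add]; ring
        have e1 : Real.exp (μ * t) ≤ Real.exp ((2 * a + (d - 2) * b) * t) :=
          Real.exp_le_exp.2 (mul_le_mul_of_nonpos_right hb1 ht)
        have e2 : Real.exp (μ * t) ≤ Real.exp ((2 * a + d * b) * t) :=
          Real.exp_le_exp.2 (mul_le_mul_of_nonpos_right hb2 ht)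
        have e3 := mul_le_mul_of_nonneg_left e1 (mul_nonneg h1 hG.le)
        have e4 := mul_le_mul_of_nonneg_left e2 (mul_nonneg h2 hM.le)
        have e5 := mul_le_mul_of_nonneg_left hle (Real.exp_pos (μ * t)).le
        rw [Kfun_rescale]
        unfold KQfun at e5
        linarith)
    have hmle := hm _ (SchwartzMap.rescale_ne_zero hφ (a * t) (b * t)) ht
    simp only [mul_zero, φ.rescale_zero] at hle
    linarith [mul_le_mul_of_nonneg_left hmle hμ.le]
  · left
    rw [min_le_iff]
    by_contra! hcon
    obtain ⟨hc1, hc2⟩ := hcon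
    rw [div_mul_eq_mul_div, lt_div_iff₀ (by positivity)] at hc2
    obtain ⟨t, ht, hle⟩ := exists_zero_right hμ hγ.le hJ hK (hasDerivAt_fluxFlow φ hf a (d * b))
      (fun t => le_trans (mul_nonneg (by positivity) (hfl0 t)) (hflux t)) hKbound
      (by simpa [φ.rescale_zero] using hpos)
      (by
        have hfl : fluxFlow φ f a (d * b) 0 = KQfun a b φ - Kfun f a b φ := by linarith
        simp only [mul_zero, φ.rescale_zero, hfl]
        linarith)
    have hmle := hm _ (SchwartzMap.rescale_ne_zero hφ (a * t) (b * t)) ht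
    simp only [mul_zero, φ.rescale_zero] at hle
    linarith [mul_le_mul_of_nonneg_left hmle hμ.le]

/-- Superquadraticity under amplification of the function. -/
lemma exp_mul_integral_le (t : ℝ) (ht : 0 ≤ t) :
    Real.exp (p * t) * ∫ x, f (φ x) ≤ ∫ x, f (Real.exp t * φ x) := by
  have hd := hasDerivAt_exp_mul_integral_nonlinearity φ hf 1 0
  have hle := fun t => mul_integral_le_fluxFlow φ hf zero_le_one 0 t
  simp only [one_mul, add_zero] at hd hle
  have := monotone_exp_neg_mul hd hle ht
  simp only [zero_mul, mul_zero, neg_zero, Real.exp_zero, one_mul] at this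
  calc Real.exp (p * t) * ∫ x, f (φ x)
      ≤ Real.exp (p * t) * (Real.exp (-(p * t)) * ∫ x, f (Real.exp t * φ x)) := by gcongr
    _ = _ := by rw [← mul_assoc, ← Real.exp_add]; simp

omit hf in
lemma Kfun_zero_eq (f : ℝ → ℝ) (b : ℝ) (ψ : SchwartzMap (EuclideanSpace ℝ (Fin d)) ℝ) :
    Kfun f 0 b ψ = b * (d * Jfun f ψ - gradN2 ψ) := by
  unfold Kfun KQfun Jfun Ffun
  simp only [zero_mul, zero_add, integral_const_mul, mul_zero]
  ring

omit hf in
/-- A Sobolev-type bound with constants independent of the nonlinearity: below the level `m`, the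
potential energy of the amplified function is controlled by the gradient. -/
lemma integral_exp_one_le (hd : 3 ≤ d) {b m : ℝ}
    (hm : ∀ ψ : SchwartzMap (EuclideanSpace ℝ (Fin d)) ℝ, ψ ≠ 0 → Kfun f 0 b ψ = 0 → m ≤ Jfun f ψ)
    (hφ : φ ≠ 0) (hGm : gradN2 φ < d * m) :
    d * ∫ x, f (Real.exp 1 * φ x) ≤ Real.exp 2 * (d / 2 * massN2 φ)
      + Real.exp 6 * ((d - 2) / 2 * gradN2 φ) := by
  have hd3 : (3 : ℝ) ≤ d := by exact_mod_cast hd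
  have hG := gradN2_pos (by omega) hφ
  by_contra! hcon
  set N := d * (∫ x, f (Real.exp 1 * φ x)) - Real.exp 2 * (d / 2 * massN2 φ) with hN
  set g := (d - 2) / 2 * gradN2 φ with hg
  have hgpos : 0 < g := mul_pos (by linarith) hG
  have hNg : Real.exp 6 * g < N := by rw [hN]; linarith
  have hNpos : 0 < N := lt_trans (by positivity) hNg
  have hratio : 0 < Real.exp 2 * g / N := by positivity
  set t := Real.log (Real.exp 2 * g / N) / 2 with ht
  have h2t : Real.exp (2 * t) * N = Real.exp 2 * g := by
    rw [ht, mul_div_cancel₀ _ two_ne_zero, Real.exp_log hratio]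
    field_simp
  have htlt : t < -2 := by
    have : Real.exp (2 * t) < Real.exp (-4) := by
      have h6 : Real.exp 2 * g = Real.exp (-4) * (Real.exp 6 * g) := by
        have h42 : Real.exp 2 = Real.exp (-4) * Real.exp 6 := by rw [← Real.exp_add]; norm_num
        rw [h42]; ring
      have : Real.exp (2 * t) * N < Real.exp (-4) * N := by
        rw [h2t, h6]; gcongr
      exact lt_of_mul_lt_mul_right this hNpos.le
    have := Real.exp_lt_exp.1 this
    linarith
  have hJ : Jfun f (φ.rescale 1 t) = (Real.exp (2 + (d - 2) * t) * gradN2 φ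
      + Real.exp (2 + d * t) * massN2 φ) / 2
      - Real.exp (d * t) * ∫ x, f (Real.exp 1 * φ x) := by
    unfold Jfun Ffun
    rw [gradN2_rescale, massN2_rescale, integral_comp_rescale]
    norm_num
  have hgrad : gradN2 (φ.rescale 1 t) = Real.exp (2 + (d - 2) * t) * gradN2 φ := by
    rw [gradN2_rescale]; norm_num
  have hzero : d * Jfun f (φ.rescale 1 t) = gradN2 (φ.rescale 1 t) := by
    have e1 : Real.exp (2 + (d - 2) * t) = Real.exp ((d - 2) * t) * Real.exp 2 := by
      rw [← Real.exp_add]; ring_nf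
    have e2 : Real.exp (2 + d * t) = Real.exp ((d - 2) * t) * Real.exp (2 * t) * Real.exp 2 := by
      rw [← Real.exp_add, ← Real.exp_add]; ring_nf
    have e3 : Real.exp (d * t) = Real.exp ((d - 2) * t) * Real.exp (2 * t) := by
      rw [← Real.exp_add]; ring_nf
    rw [hJ, hgrad, e1, e2, e3]
    have := congrArg (Real.exp ((d - 2) * t) * ·) h2t
    simp only [hN, hg] at this
    linarith
  have hmle := hm _ (SchwartzMap.rescale_ne_zero hφ 1 t) (by rw [Kfun_zero_eq, hzero]; ring)
  have hsmall : gradN2 (φ.rescale 1 t) ≤ gradN2 φ := by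
    rw [hgrad]
    have : Real.exp (2 + (d - 2) * t) ≤ 1 := Real.exp_le_one_iff.2 (by nlinarith)
    nlinarith
  have : (d : ℝ) * m ≤ d * Jfun f (φ.rescale 1 t) := by gcongr
  linarith

/-- The bounds on `Kfun` below the level `m` for pure dilations. -/
lemma Kfun_dichotomy_of_dilation (hd : 3 ≤ d) {ε b m δ : ℝ} (hε : 0 < ε) (hp : 2 + ε ≤ p)
    (hb : 0 < b) (hδ : 0 < δ) (hδ₁ : δ * (2 * (1 + ε)) ≤ ε)
    (hδ₂ : δ * (d * (1 + 2 * Real.exp 4 / ε)) ≤ 1)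
    (hm : ∀ ψ : SchwartzMap (EuclideanSpace ℝ (Fin d)) ℝ, ψ ≠ 0 → Kfun f 0 b ψ = 0 → m ≤ Jfun f ψ)
    (hφ : φ ≠ 0) :
    (min (d * b * (m - Jfun f φ)) (δ * KQfun 0 b φ) ≤ Kfun f 0 b φ
      ∨ Kfun f 0 b φ ≤ -(d * b * (m - Jfun f φ))) := by
  have hd3 : (3 : ℝ) ≤ d := by exact_mod_cast hd
  have hG := gradN2_pos (by omega) hφ
  have hM := massN2_pos hφ
  have hμ : 0 < d * b := by positivity
  have hgap : 0 < (d - 2) * b := mul_pos (by linarith) hb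
  have hJ := hasDerivAt_Jfun_rescale φ hf 0 b
  have hK := hasDerivAt_Kfun_rescale φ hf 0 b
  have hflux := mul_fluxFlow_le φ hf (a := 0) (b := d * b) (c := d * b) le_rfl (by linarith) hμ.le
    (by linarith)
  have hKbound : ∀ t, ((2 * 0 + (d - 2) * b) * ((2 * 0 + (d - 2) * b) *
          (Real.exp ((2 * 0 + (d - 2) * b) * t) * gradN2 φ))
        + (2 * 0 + d * b) * ((2 * 0 + d * b) * (Real.exp ((2 * 0 + d * b) * t) * massN2 φ))) / 2
      - fluxFlowDeriv φ f 0 (d * b) t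
      ≤ d * b * Kfun f 0 b (φ.rescale (0 * t) (b * t))
        - (d - 2) * b * b * (Real.exp ((d - 2) * b * t) * gradN2 φ) := by
    intro t
    rw [Kfun_rescale]
    simp only [mul_zero, zero_add]
    linarith [hflux t]
  rcases le_or_gt (Kfun f 0 b φ) 0 with hneg | hpos
  · right
    obtain ⟨t, ht, hle⟩ := exists_zero_left (μ := d * b) hJ hK
      (fun t => by
        have : 0 ≤ (d - 2) * b * b * (Real.exp ((d - 2) * b * t) * gradN2 φ) := by positivity
        linarith [hKbound t])
      (by simpa [φ.rescale_zero] using hneg) (by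
        obtain ⟨t, ht, hle⟩ := exists_le_zero_mul_exp_le (c := 2 * b) (d * b * ∫ x, f (φ x))
          (show 0 < (d - 2) * b * gradN2 φ / 2 by positivity) (by positivity)
        refine ⟨t, ht, ?_⟩
        have e3 : Real.exp (d * b * t) = Real.exp ((d - 2) * b * t) * Real.exp (2 * b * t) := by
          rw [← Real.exp_add]; ring_nf
        have e4 := mul_le_mul_of_nonneg_left hle (Real.exp_pos ((d - 2) * b * t)).le
        have e5 : 0 ≤ d * b * (Real.exp (d * b * t) * massN2 φ) := by positivity
        have e6 : fluxFlow φ f 0 (d * b) t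
            = Real.exp ((d - 2) * b * t) * Real.exp (2 * b * t) * (d * b * ∫ x, f (φ x)) := by
          simp only [fluxFlow, fluxDensity, zero_mul, zero_add, Real.exp_zero, one_mul,
            integral_const_mul, e3]
        rw [Kfun_rescale, e6]
        simp only [mul_zero, zero_add]
        linarith)
    have hmle := hm _ (SchwartzMap.rescale_ne_zero hφ (0 * t) (b * t)) ht
    simp only [mul_zero, φ.rescale_zero] at hle
    linarith [mul_le_mul_of_nonneg_left hmle hμ.le]
  · left
    rw [min_le_iff]
    by_contra! hcon
    obtain ⟨hc1, hc2⟩ := hcon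
    have hKJ := Kfun_zero_eq f b φ
    have hGm : gradN2 φ < d * m := by
      have h1 : 0 < d * Jfun f φ - gradN2 φ := by
        rw [hKJ] at hpos
        exact pos_of_mul_pos_right hpos hb.le
      have h2 : 0 < d * b * (m - Jfun f φ) := hpos.trans hc1
      have h3 := pos_of_mul_pos_right h2 hμ.le
      nlinarith
    have hsob := integral_exp_one_le φ hd hm hφ hGm
    have hamp := exp_mul_integral_le φ hf 1 zero_le_one
    set I := ∫ x, f (φ x) with hI
    have hI0 : 0 ≤ I := integral_nonneg fun _ => hf.nonneg _
    set g := (d - 2) / 2 * gradN2 φ with hg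
    set M := d / 2 * massN2 φ with hMdef
    have hgpos : 0 < g := mul_pos (by linarith) hG
    have hMpos : 0 < M := by positivity
    have hexp : Real.exp 2 * (1 + ε) ≤ Real.exp (p * 1) := by
      calc Real.exp 2 * (1 + ε) ≤ Real.exp 2 * Real.exp ε := by
            gcongr; linarith [Real.add_one_le_exp ε]
        _ = Real.exp (2 + ε) := (Real.exp_add _ _).symm
        _ ≤ Real.exp (p * 1) := Real.exp_le_exp.2 (by linarith)
    have hF : (1 + ε) * (d * I) ≤ M + Real.exp 4 * g := by
      have h6 : Real.exp 6 = Real.exp 2 * Real.exp 4 := by rw [← Real.exp_add]; norm_num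
      have h7 : Real.exp 2 * ((1 + ε) * (d * I)) ≤ Real.exp 2 * (M + Real.exp 4 * g) := by
        calc Real.exp 2 * ((1 + ε) * (d * I)) = d * (Real.exp 2 * (1 + ε) * I) := by ring
          _ ≤ d * (Real.exp (p * 1) * I) := by gcongr
          _ ≤ d * ∫ x, f (Real.exp 1 * φ x) := by gcongr
          _ ≤ Real.exp 2 * (M + Real.exp 4 * g) := by rw [h6] at hsob; linarith
      exact le_of_mul_le_mul_left h7 (Real.exp_pos 2)
    have hKQeq : KQfun 0 b φ = b * (g + M) := by
      unfold KQfun; rw [hg, hMdef]; ring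
    have hKeq : Kfun f 0 b φ = b * (g + M - d * I) := by
      rw [hKJ, hg, hMdef]; unfold Jfun Ffun; ring
    have hc3 : g + M - d * I < δ * (g + M) := by
      rw [hKeq, hKQeq, mul_left_comm] at hc2
      exact lt_of_mul_lt_mul_left hc2 hb.le
    have hMg : M ≤ 2 * Real.exp 4 / ε * g := by
      rw [div_mul_eq_mul_div, le_div_iff₀ hε]
      have h8 : (1 + ε) * ((1 - δ) * (g + M)) ≤ (1 + ε) * (d * I) := by
        refine mul_le_mul_of_nonneg_left ?_ (by linarith)
        linarith
      have h9 : (δ * (2 * (1 + ε))) * (g + M) ≤ ε * (g + M) := by gcongr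
      nlinarith
    have hKsmall : d * Kfun f 0 b φ ≤ b * g := by
      have h10 : g + M ≤ (1 + 2 * Real.exp 4 / ε) * g := by linarith
      calc d * Kfun f 0 b φ = d * b * (g + M - d * I) := by rw [hKeq]; ring
        _ ≤ d * b * (δ * ((1 + 2 * Real.exp 4 / ε) * g)) := by
            refine mul_le_mul_of_nonneg_left (hc3.le.trans ?_) hμ.le
            gcongr
        _ = (δ * (d * (1 + 2 * Real.exp 4 / ε))) * (b * g) := by ring
        _ ≤ 1 * (b * g) := by gcongr
        _ = b * g := one_mul _
    obtain ⟨t, ht, hle⟩ := exists_zero_right hμ (mul_nonneg hgap.le hb.le) hJ hK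
      (hasDerivAt_exp_mul_const ((d - 2) * b) (gradN2 φ))
      (fun t => by positivity) hKbound
      (by simpa [φ.rescale_zero] using hpos)
      (by
        simp only [mul_zero, φ.rescale_zero, Real.exp_zero, one_mul]
        have := mul_le_mul_of_nonneg_left hKsmall hb.le
        rw [hg] at this
        linarith)
    have hmle := hm _ (SchwartzMap.rescale_ne_zero hφ (0 * t) (b * t)) ht
    simp only [mul_zero, φ.rescale_zero] at hle
    linarith [mul_le_mul_of_nonneg_left hmle hμ.le]

end Flow

end Auxiliary

theorem stmt9 (d : ℕ) (hd : 2 ≤ d) (ε α β : ℝ) (hε : 0 < ε)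
    (hα : 0 ≤ α) (h1 : 0 ≤ 2*α + (d:ℝ)*β) (h2 : 0 ≤ 2*α + ((d:ℝ)-2)*β)
    (hne : (α, β) ≠ (0, 0)) (hda : ¬ (d = 2 ∧ α = 0)) :
    ∃ δ > 0, ∀ f : ℝ → ℝ,
      Differentiable ℝ f → Differentiable ℝ (deriv f) →
      (∀ u : ℝ, 0 ≤ f u) →
      (∀ u : ℝ, (2 + 4/(d:ℝ) + ε) * f u ≤ u * deriv f u) →
      (∀ u : ℝ, 0 ≤ u^2 * deriv (deriv f) u
          - (1 + (2 + 4/(d:ℝ) + ε)) * (u * deriv f u) + 2 * (2 + 4/(d:ℝ) + ε) * f u) →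
      (∃ C > 0, ∃ q₁ q₂ : ℝ, 2 + 4/(d:ℝ) < q₁ ∧ q₁ ≤ q₂ ∧
          (3 ≤ d → q₂ ≤ 2 + 4/((d:ℝ)-2)) ∧
          ∀ u : ℝ, |f u| + |u * deriv f u| + |u^2 * deriv (deriv f) u|
            ≤ C * (|u| ^ q₁ + |u| ^ q₂)) →
      (∃ ψ : SchwartzMap (EuclideanSpace ℝ (Fin d)) ℝ, ψ ≠ 0 ∧ Kfun f α β ⇑ψ = 0) →
      ∀ m : ℝ,
        m = sInf {x : ℝ | ∃ ψ : SchwartzMap (EuclideanSpace ℝ (Fin d)) ℝ,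
            ψ ≠ 0 ∧ Kfun f α β ⇑ψ = 0 ∧ x = Jfun f ⇑ψ} →
        0 ≤ m ∧
        ∀ φ : SchwartzMap (EuclideanSpace ℝ (Fin d)) ℝ, Jfun f ⇑φ < m →
          (min (max (2*α + (d:ℝ)*β) (2*α + ((d:ℝ)-2)*β) * (m - Jfun f ⇑φ))
              (δ * KQfun α β ⇑φ) ≤ Kfun f α β ⇑φ
            ∨ Kfun f α β ⇑φ
              ≤ -(max (2*α + (d:ℝ)*β) (2*α + ((d:ℝ)-2)*β) * (m - Jfun f ⇑φ))) := by
  have hd0 : (0 : ℝ) < d := by exact_mod_cast (by omega : 0 < d)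
  have hpow : ∀ {f : ℝ → ℝ}, Differentiable ℝ f → Differentiable ℝ (deriv f) →
      (∀ u : ℝ, 0 ≤ f u) → (∀ u : ℝ, (2 + 4/(d:ℝ) + ε) * f u ≤ u * deriv f u) →
      (∀ u : ℝ, 0 ≤ u^2 * deriv (deriv f) u
          - (1 + (2 + 4/(d:ℝ) + ε)) * (u * deriv f u) + 2 * (2 + 4/(d:ℝ) + ε) * f u) →
      (∃ C > 0, ∃ q₁ q₂ : ℝ, 2 + 4/(d:ℝ) < q₁ ∧ q₁ ≤ q₂ ∧
          (3 ≤ d → q₂ ≤ 2 + 4/((d:ℝ)-2)) ∧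
          ∀ u : ℝ, |f u| + |u * deriv f u| + |u^2 * deriv (deriv f) u|
            ≤ C * (|u| ^ q₁ + |u| ^ q₂)) →
      ∃ q₁ q₂, ConvexNonlinearity (2 + 4/(d:ℝ) + ε) q₁ q₂ f := by
    rintro f hf1 hf2 hf3 hf4 hf5 ⟨C, hC, q₁, q₂, hq₁, hq₂, -, hb⟩
    have hq0 : 0 < q₁ := lt_trans (by positivity) hq₁
    refine ⟨q₁, q₂, hf1, hf2, hf3, hf4, hf5, ⟨C, hC.le, fun u => ?_⟩, ⟨C, hC.le, fun u => ?_⟩,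
      ⟨C, hC.le, fun u => ?_⟩, hq0, hq0.trans_le hq₂⟩ <;>
    linarith [hb u, abs_nonneg (f u), abs_nonneg (u * deriv f u),
      abs_nonneg (u ^ 2 * deriv (deriv f) u)]
  set μ := max (2*α + (d:ℝ)*β) (2*α + ((d:ℝ)-2)*β) with hμdef
  have hμ1 : 2*α + (d:ℝ)*β ≤ μ := le_max_left _ _
  have hμ2 : 2*α + ((d:ℝ)-2)*β ≤ μ := le_max_right _ _
  have hμp : μ + α * ε ≤ α * (2 + 4/(d:ℝ) + ε) + d * β := by
    have h4 : 0 ≤ α * (4 / (d:ℝ)) := by positivity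
    have h5 : 0 ≤ (2 * α + d * β) * (2 / d) := by positivity
    have h6 : (2 * α + d * β) * (2 / d) = α * (4 / d) + 2 * β := by field_simp; ring
    have : μ ≤ α * (2 + 4/(d:ℝ)) + d * β := max_le (by linarith) (by linarith)
    linarith
  have hμ : 0 < μ := by
    by_contra! hμ0
    have hβ : β = 0 := by linarith
    have hα0 : α = 0 := by subst hβ; linarith
    exact hne (by rw [hα0, hβ])
  obtain ⟨δ, hδ, hmain⟩ : ∃ δ > 0, ∀ (f : ℝ → ℝ) (q₁ q₂ m : ℝ)
      (φ : SchwartzMap (EuclideanSpace ℝ (Fin d)) ℝ),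
      ConvexNonlinearity (2 + 4/(d:ℝ) + ε) q₁ q₂ f →
      (∀ ψ : SchwartzMap (EuclideanSpace ℝ (Fin d)) ℝ,
        ψ ≠ 0 → Kfun f α β ψ = 0 → m ≤ Jfun f ψ) → φ ≠ 0 →
      (min (μ * (m - Jfun f ⇑φ)) (δ * KQfun α β ⇑φ) ≤ Kfun f α β ⇑φ
        ∨ Kfun f α β ⇑φ ≤ -(μ * (m - Jfun f ⇑φ))) := by
    rcases hα.eq_or_lt with rfl | hαpos
    · have hβ : 0 < β := by
        refine lt_of_le_of_ne ?_ fun h => hne (by rw [← h])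
        exact nonneg_of_mul_nonneg_right (by linarith) hd0
      have hμeq : μ = d * β := by
        rw [hμdef, max_eq_left (by linarith)]; ring
      have hd3 : 3 ≤ d := by
        by_contra hlt
        exact hda ⟨by omega, rfl⟩
      refine ⟨min (ε / (2 * (1 + ε))) (1 / (d * (1 + 2 * Real.exp 4 / ε))), by positivity,
        fun f q₁ q₂ m φ hf hm hφ => ?_⟩
      rw [hμeq]
      refine Kfun_dichotomy_of_dilation φ hf hd3 hε ?_ hβ (by positivity) ?_ ?_ hm hφ
      · have : 0 < 4 / (d : ℝ) := by positivity
        linarith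
      · exact (le_div_iff₀ (by positivity)).1 (min_le_left _ _)
      · exact (le_div_iff₀ (by positivity)).1 (min_le_right _ _)
    · have hγ : 0 < α * ε := mul_pos hαpos hε
      exact ⟨α * ε / (2 * μ + α * ε), by positivity, fun f q₁ q₂ m φ hf hm hφ =>
        Kfun_dichotomy_of_pos φ hf (by omega) hα hμ hγ h2 h1 hμdef hμp hm hφ⟩
  refine ⟨δ, hδ, fun f hf1 hf2 hf3 hf4 hf5 hf6 _ m hm => ?_⟩
  obtain ⟨q₁, q₂, hf⟩ := hpow hf1 hf2 hf3 hf4 hf5 hf6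
  have hαε : 0 ≤ α * ε := mul_nonneg hα hε.le
  have hJ0 : ∀ ψ : SchwartzMap (EuclideanSpace ℝ (Fin d)) ℝ, Kfun f α β ψ = 0 → 0 ≤ Jfun f ψ :=
    fun ψ hψ => Jfun_nonneg_of_Kfun_eq_zero ψ hf hα hμ hμ2 hμ1 (by linarith) hψ
  have hmle : ∀ ψ : SchwartzMap (EuclideanSpace ℝ (Fin d)) ℝ, ψ ≠ 0 → Kfun f α β ψ = 0 →
      m ≤ Jfun f ψ := by
    intro ψ hψ hK
    rw [hm]
    refine csInf_le ⟨0, ?_⟩ ⟨ψ, hψ, hK, rfl⟩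
    rintro x ⟨ψ', -, hK', rfl⟩
    exact hJ0 ψ' hK'
  refine ⟨?_, fun φ _ => ?_⟩
  · rw [hm]
    refine Real.sInf_nonneg ?_
    rintro x ⟨ψ, -, hK, rfl⟩
    exact hJ0 ψ hK
  · rcases eq_or_ne φ 0 with rfl | hφ
    · left
      have hf0 : f 0 = 0 := by
        have h3 := hf4 0
        have h4 := hf3 0
        have h5 : 0 < 2 + 4 / (d : ℝ) + ε := by positivity
        rw [zero_mul] at h3
        nlinarith
      have hKQ : KQfun α β ⇑(0 : SchwartzMap (EuclideanSpace ℝ (Fin d)) ℝ) = 0 := by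
        have hcoe : (⇑(0 : SchwartzMap (EuclideanSpace ℝ (Fin d)) ℝ)) = fun _ => (0 : ℝ) := rfl
        simp [KQfun, gradN2, massN2, hcoe]
      refine (min_le_right _ _).trans ?_
      rw [Kfun, hKQ]
      simp [hf0]
    · exact hmain f q₁ q₂ m φ hf hmle hφ
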